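/- arXiv:2506.10843 — 5 statements merged into one kernel-verified Lean document; each statement's English description precedes it below -/
import Mathlib

section
/- For every approval-based committee election instance, every integer k with 1 ≤ k ≤ m, and any greedy run W_0, W_1, …, W_k, one has cov(W_k) ≥ (1 − (1 − 1/k)^k) · opt(k); in particular cov(W_k) ≥ (1 − 1/e) · opt(k), i.e., the greedy algorithm is (1 − 1/e)-approximate for the approval-based Chamberlin–Courant problem. -/
open Finset

/-- The coverage of a committee `W`: the number of voters `i` whose approval set
`A i` intersects `W`. -/
def cov {V C : Type*} [Fintype V] [DecidableEq C] (A : V → Finset C) (W : Finset C) : ℕ :=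
  (Finset.univ.filter fun i => (A i ∩ W).Nonempty).card

theorem cov_mono {V C : Type*} [Fintype V] [DecidableEq C] (A : V → Finset C)
    {S T : Finset C} (h : S ⊆ T) : cov A S ≤ cov A T :=
  card_le_card <| monotone_filter_right _ fun _ _ hi => hi.mono (inter_subset_inter_left h)

/-- The coverage of `O` exceeds that of `W` by at most the sum of the marginal gains over `W`
of the members of `O`. -/
theorem cov_le_cov_add_sum_gain {V C : Type*} [Fintype V] [DecidableEq C] (A : V → Finset C)
    (W O : Finset C) :
    cov A O ≤ cov A W + ∑ c ∈ O, (cov A (insert c W) - cov A W) := by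
  classical
  let covered (S : Finset C) : Finset V := univ.filter fun i => (A i ∩ S).Nonempty
  have hsub : covered O ⊆ covered W ∪ O.biUnion fun c => covered (insert c W) \ covered W := by
    intro i hi
    obtain ⟨c, hc⟩ := (mem_filter.1 hi).2
    obtain ⟨hcA, hcO⟩ := mem_inter.1 hc
    by_cases hW : i ∈ covered W
    · exact mem_union_left _ hW
    · refine mem_union_right _ (mem_biUnion.2 ⟨c, hcO, mem_sdiff.2 ⟨?_, hW⟩⟩)
      exact mem_filter.2 ⟨mem_univ i, c, mem_inter.2 ⟨hcA, mem_insert_self c W⟩⟩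
  have hcard (c : C) : (covered (insert c W) \ covered W).card =
      cov A (insert c W) - cov A W :=
    card_sdiff_of_subset <| monotone_filter_right _ fun _ _ hi =>
      hi.mono (inter_subset_inter_left (subset_insert c W))
  calc cov A O ≤ _ := card_le_card hsub
    _ ≤ _ := card_union_le _ _
    _ ≤ cov A W + ∑ c ∈ O, (covered (insert c W) \ covered W).card :=
      Nat.add_le_add_left card_biUnion_le _
    _ = _ := by simp only [hcard]

/-- If no candidate has a marginal gain over `W` exceeding `g`, then `cov O ≤ cov W + |O| · g`. -/
theorem cov_le_cov_add_card_mul {V C : Type*} [Fintype V] [DecidableEq C] (A : V → Finset C)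
    (W O : Finset C) {g : ℝ}
    (hg : ∀ c, (cov A (insert c W) : ℝ) - cov A W ≤ g) :
    (cov A O : ℝ) ≤ cov A W + O.card * g := by
  have h : (cov A O : ℝ) ≤
      cov A W + ∑ c ∈ O, ((cov A (insert c W) : ℝ) - cov A W) := by
    have h := cov_le_cov_add_sum_gain A W O
    rw [← Nat.cast_le (α := ℝ)] at h
    simpa [Nat.cast_sub (cov_mono A (subset_insert _ W))] using h
  have hsum := sum_le_card_nsmul O _ g fun c _ => hg c
  rw [nsmul_eq_mul] at hsum
  linarith

/-- The greedy algorithm is `(1 - 1/e)`-approximate for the approval-based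
Chamberlin–Courant (Maximum Coverage) problem: any greedy run `W 0, …, W k`
satisfies `cov (W k) ≥ (1 - (1 - 1/k)^k) · opt k`, and in particular
`cov (W k) ≥ (1 - 1/e) · opt k`. -/
theorem greedy_approximation
    {V C : Type*} [Fintype V] [Fintype C] [DecidableEq C]
    (A : V → Finset C) (k : ℕ) (hk : 1 ≤ k) (hkm : k ≤ Fintype.card C)
    (W : ℕ → Finset C) (c : ℕ → C)
    (hW0 : W 0 = ∅)
    (hstep : ∀ j < k, W (j + 1) = insert (c (j + 1)) (W j))
    (hnew : ∀ j < k, c (j + 1) ∉ W j)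
    (hmax : ∀ j < k, ∀ c' : C, c' ∉ W j →
      (cov A (insert (c (j + 1)) (W j)) : ℝ) - cov A (W j) ≥
        (cov A (insert c' (W j)) : ℝ) - cov A (W j))
    (O : Finset C) (hO : O.card = k) :
    (cov A (W k) : ℝ) ≥ (1 - (1 - 1 / k) ^ k) * cov A O ∧
    (cov A (W k) : ℝ) ≥ (1 - (Real.exp 1)⁻¹) * cov A O := by
  have hk0 : (0 : ℝ) < k := by exact_mod_cast hk
  have hk1 : (1 : ℝ) / k ≤ 1 := by
    rw [div_le_one hk0]
    exact_mod_cast hk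
  have hgap : ∀ j ≤ k,
      (cov A O : ℝ) - cov A (W j) ≤ (1 - 1 / k) ^ j * cov A O := by
    intro j
    induction j with
    | zero => simp
    | succ j ih =>
      intro hj
      have hbound : (cov A O : ℝ) ≤
          cov A (W j) + k * ((cov A (W (j + 1)) : ℝ) - cov A (W j)) := by
        rw [← hO, hstep j hj]
        refine cov_le_cov_add_card_mul A (W j) O fun c' => ?_
        by_cases hc' : c' ∈ W j
        · rw [insert_eq_of_mem hc', sub_self, sub_nonneg]
          exact_mod_cast cov_mono A (subset_insert _ _)
        · exact hmax j hj c' hc'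
      have hdiv : ((cov A O : ℝ) - cov A (W j)) * (1 / k) ≤
          (cov A (W (j + 1)) : ℝ) - cov A (W j) := by
        rw [mul_one_div, div_le_iff₀ hk0]
        linarith
      calc (cov A O : ℝ) - cov A (W (j + 1))
          ≤ (1 - 1 / k) * ((cov A O : ℝ) - cov A (W j)) := by linarith
        _ ≤ (1 - 1 / k) * ((1 - 1 / k) ^ j * cov A O) :=
          mul_le_mul_of_nonneg_left (ih (Nat.le_of_succ_le hj)) (sub_nonneg.2 hk1)
        _ = (1 - 1 / k) ^ (j + 1) * cov A O := by ring
  have hratio : (cov A (W k) : ℝ) ≥ (1 - (1 - 1 / k) ^ k) * cov A O := by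
    linarith [hgap k le_rfl]
  refine ⟨hratio, le_trans ?_ hratio⟩
  have hexp : (1 - 1 / (k : ℝ)) ^ k ≤ (Real.exp 1)⁻¹ := by
    rw [← Real.exp_neg]
    exact Real.one_sub_div_pow_le_exp_neg (by exact_mod_cast hk)
  gcongr
end

section
/- Let k ≥ 1 be an integer and T ≥ 0 a real number. If g_0, g_1, …, g_k are real numbers with g_0 ≥ 0 and g_j ≥ g_{j−1} + (T − g_{j−1})/k for all 1 ≤ j ≤ k, then g_k ≥ T · (1 − (1 − 1/k)^k). -/
/-- The recurrence underlying the greedy analysis for Maximum Coverage: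
if `g 0 ≥ 0` and `g j ≥ g (j-1) + (T - g (j-1)) / k` for `1 ≤ j ≤ k`, then
`g k ≥ T * (1 - (1 - 1/k)^k)`. -/
theorem greedy_recurrence
    (k : ℕ) (hk : 1 ≤ k) (T : ℝ) (hT : 0 ≤ T) (g : ℕ → ℝ)
    (hg0 : 0 ≤ g 0)
    (hrec : ∀ j < k, g (j + 1) ≥ g j + (T - g j) / k) :
    g k ≥ T * (1 - (1 - 1 / k) ^ k) := by
  have hr : (0 : ℝ) ≤ 1 - 1 / k :=
    sub_nonneg.2 (div_le_one_of_le₀ (by exact_mod_cast hk) k.cast_nonneg)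
  have hgap : T - g k ≤ (1 - 1 / (k : ℝ)) ^ k * (T - g 0) :=
    le_geom (u := fun j => T - g j) hr k fun j hj => by
      have h : (1 - 1 / (k : ℝ)) * (T - g j) = T - (g j + (T - g j) / k) := by ring
      rw [h]
      exact sub_le_sub_left (hrec j hj) T
  linarith [mul_nonneg (pow_nonneg hr k) hg0]
end

section
/- Let k ≥ 1 be an integer, T ≥ 0 and ε ≥ 0 real numbers. If g_0, g_1, …, g_k are real numbers with g_0 = 0 and g_j ≥ g_{j−1} + (T − g_{j−1})/k − ε for all 1 ≤ j ≤ k, then g_k ≥ (T − εk) · (1 − (1 − 1/k)^k). -/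
/-- A sequence starting at `0` that moves at least a fraction `1 - r` of the way towards `b` in each
of its first `n` steps satisfies `b * (1 - r ^ n) ≤ g n`. -/
theorem mul_one_sub_pow_le_of_recurrence {r b : ℝ} (hr : 0 ≤ r) {g : ℕ → ℝ} (hg0 : g 0 = 0) {n : ℕ}
    (hg : ∀ j < n, r * g j + b * (1 - r) ≤ g (j + 1)) : b * (1 - r ^ n) ≤ g n := by
  induction n with
  | zero => simp [hg0]
  | succ n ih =>
    calc b * (1 - r ^ (n + 1)) = r * (b * (1 - r ^ n)) + b * (1 - r) := by ring
      _ ≤ r * g n + b * (1 - r) := by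
        gcongr
        exact ih fun j hj => hg j (hj.trans n.lt_succ_self)
      _ ≤ g (n + 1) := hg n n.lt_succ_self

/-- The perturbed recurrence underlying the greedy-ε analysis for Maximum
Coverage: if `g 0 = 0` and `g j ≥ g (j-1) + (T - g (j-1)) / k - ε` for
`1 ≤ j ≤ k`, then `g k ≥ (T - ε * k) * (1 - (1 - 1/k)^k)`. -/
theorem greedy_eps_recurrence
    (k : ℕ) (hk : 1 ≤ k) (T : ℝ) (hT : 0 ≤ T) (ε : ℝ) (hε : 0 ≤ ε) (g : ℕ → ℝ)
    (hg0 : g 0 = 0)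
    (hrec : ∀ j < k, g (j + 1) ≥ g j + (T - g j) / k - ε) :
    g k ≥ (T - ε * k) * (1 - (1 - 1 / k) ^ k) := by
  have hk1 : (1 : ℝ) ≤ k := by exact_mod_cast hk
  have hk0 : (k : ℝ) ≠ 0 := by positivity
  refine mul_one_sub_pow_le_of_recurrence (sub_nonneg.2 (div_le_one_of_le₀ hk1 (by positivity))) hg0
    fun j hj => le_trans (le_of_eq ?_) (hrec j hj)
  field_simp
  ring
end

section
/- Let C be a finite set partitioned into pairwise disjoint groups C_1, …, C_s, let k be a natural number, and for each group i let lower and upper quotas q_i^⊥ ≤ q_i^⊤ be given. Define I = {W ⊆ C : |W| = k and q_i^⊥ ≤ |W ∩ C_i| ≤ q_i^⊤ for all i ∈ [s]} and let 𝓘 = I ∪ {W' : W' ⊆ W for some W ∈ I} be its downward closure. If I is nonempty, then (C, 𝓘) is a matroid whose rank equals k (i.e., 𝓘 contains the empty set, is closed under subsets, satisfies the exchange/augmentation axiom, and all its maximal members have cardinality k). -/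
open Finset

/-- Swapping `y ∈ W` for `x ∉ W` changes the size of the intersection with `S` by the difference
of the membership indicators. -/
theorem card_insert_erase_inter_add {C : Type*} [DecidableEq C] {W : Finset C} {x y : C}
    (hx : x ∉ W) (hy : y ∈ W) (S : Finset C) :
    (insert x (W.erase y) ∩ S).card + (if y ∈ S then 1 else 0) =
      (W ∩ S).card + (if x ∈ S then 1 else 0) := by
  have erase_count : ((W.erase y) ∩ S).card + (if y ∈ S then 1 else 0) = (W ∩ S).card := by
    rw [Finset.erase_inter]
    split_ifs with h
    · exact Finset.card_erase_add_one (Finset.mem_inter.2 ⟨hy, h⟩)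
    · rw [Finset.erase_eq_of_notMem (by simp [h]), add_zero]
  have insert_count : (insert x (W.erase y) ∩ S).card =
      ((W.erase y) ∩ S).card + (if x ∈ S then 1 else 0) := by
    split_ifs with h
    · rw [Finset.insert_inter_of_mem h, Finset.card_insert_of_notMem (by simp [hx])]
    · rw [Finset.insert_inter_of_notMem h, add_zero]
  omega

theorem card_eq_sum_card_inter {C ι : Type*} [Fintype C] [DecidableEq C] [Fintype ι]
    {grp : ι → Finset C} (hdisj : ∀ i j, i ≠ j → Disjoint (grp i) (grp j))
    (hpart : Finset.univ.biUnion grp = Finset.univ) (S : Finset C) :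
    S.card = ∑ i, (S ∩ grp i).card := by
  rw [← Finset.card_biUnion, ← Finset.inter_biUnion, hpart, Finset.inter_univ]
  intro i _ j _ hij
  exact (hdisj i j hij).mono Finset.inter_subset_right Finset.inter_subset_right

/-- Augmentation for subsets of committees satisfying quotas on the parts of a partition. -/
theorem exists_insert_subset_of_quotas {C ι : Type*} [Fintype C] [DecidableEq C] [Fintype ι]
    {grp : ι → Finset C} (hdisj : ∀ i j, i ≠ j → Disjoint (grp i) (grp j))
    (hpart : Finset.univ.biUnion grp = Finset.univ) {qlo qhi : ι → ℕ} {A B V W : Finset C}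
    (hVW : V.card = W.card)
    (hV : ∀ i, qlo i ≤ (V ∩ grp i).card ∧ (V ∩ grp i).card ≤ qhi i)
    (hW : ∀ i, qlo i ≤ (W ∩ grp i).card ∧ (W ∩ grp i).card ≤ qhi i)
    (hAV : A ⊆ V) (hBW : B ⊆ W) (hcard : B.card < A.card) :
    ∃ x ∈ A \ B, ∃ U : Finset C, U.card = W.card ∧
      (∀ i, qlo i ≤ (U ∩ grp i).card ∧ (U ∩ grp i).card ≤ qhi i) ∧ insert x B ⊆ U := by
  by_contra! hno
  have hAW : ∀ x ∈ A, x ∉ B → x ∉ W := fun x hxA hxB hxW =>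
    hno x (Finset.mem_sdiff.2 ⟨hxA, hxB⟩) W rfl hW (Finset.insert_subset hxW hBW)
  have uniq : ∀ i j z, z ∈ grp i → z ∈ grp j → i = j := fun i j z hi hj => by
    by_contra hij
    exact Finset.disjoint_left.1 (hdisj i j hij) hi hj
  have swap : ∀ x ∈ A, x ∉ B → ∀ y ∈ W, y ∉ B → ∀ i j, x ∈ grp i → y ∈ grp j →
      i ≠ j ∧ ((W ∩ grp i).card < qhi i → (W ∩ grp j).card ≤ qlo j) := by
    intro x hxA hxB y hyW hyB i j hxi hyj
    have hxW := hAW x hxA hxB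
    by_contra hc
    refine hno x (Finset.mem_sdiff.2 ⟨hxA, hxB⟩) (insert x (W.erase y)) ?_ ?_ ?_
    · rw [Finset.card_insert_of_notMem (by simp [hxW]), Finset.card_erase_add_one hyW]
    · intro l
      have hcount := card_insert_erase_inter_add hxW hyW (grp l)
      have hl := hW l
      have hxl : x ∈ grp l ↔ l = i := ⟨fun h => uniq l i x h hxi, fun h => h ▸ hxi⟩
      have hyl : y ∈ grp l ↔ l = j := ⟨fun h => uniq l j y h hyj, fun h => h ▸ hyj⟩
      grind
    · exact Finset.insert_subset_insert x (Finset.subset_erase.2 ⟨hBW, hyB⟩)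
  have hA := card_eq_sum_card_inter hdisj hpart A
  have hB := card_eq_sum_card_inter hdisj hpart B
  obtain ⟨i, -, hi⟩ : ∃ i ∈ Finset.univ, (B ∩ grp i).card < (A ∩ grp i).card :=
    Finset.exists_lt_of_sum_lt (by rwa [← hA, ← hB])
  obtain ⟨x, hxA, hxB⟩ := Finset.exists_mem_notMem_of_card_lt_card hi
  obtain ⟨hxA, hxi⟩ := Finset.mem_inter.1 hxA
  replace hxB : x ∉ B := fun h => hxB (Finset.mem_inter.2 ⟨h, hxi⟩)
  have eq_of_subset : ∀ j, (∀ y ∈ W, y ∉ B → y ∉ grp j) → W ∩ grp j = B ∩ grp j := by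
    intro j h
    ext y
    have := @hBW y
    have := h y
    simp only [Finset.mem_inter]
    tauto
  have hWi : (W ∩ grp i).card < qhi i := by
    rw [eq_of_subset i fun y hyW hyB hyi => (swap x hxA hxB y hyW hyB i i hxi hyi).1 rfl]
    exact hi.trans_le ((Finset.card_le_card (Finset.inter_subset_inter_right hAV)).trans (hV i).2)
  have hle : ∀ j ∈ Finset.univ, (A ∩ grp j).card + (W ∩ grp j).card ≤
      (B ∩ grp j).card + (V ∩ grp j).card := by
    intro j _
    by_cases h : ∀ y ∈ W, y ∉ B → y ∉ grp j
    · rw [eq_of_subset j h, add_comm]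
      gcongr
    · push Not at h
      obtain ⟨y, hyW, hyB, hyj⟩ := h
      refine add_le_add (Finset.card_le_card fun z hz => ?_)
        (((swap x hxA hxB y hyW hyB i j hxi hyj).2 hWi).trans (hV j).1)
      obtain ⟨hzA, hzj⟩ := Finset.mem_inter.1 hz
      refine Finset.mem_inter.2 ⟨?_, hzj⟩
      by_contra hzB
      exact (swap z hzA hzB y hyW hyB j j hzj hyj).1 rfl
  have hsum := Finset.sum_le_sum hle
  rw [Finset.sum_add_distrib, Finset.sum_add_distrib, ← hA, ← hB,
    ← card_eq_sum_card_inter hdisj hpart, ← card_eq_sum_card_inter hdisj hpart] at hsum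
  omega

/-- The family of committees of size `k` satisfying lower and upper quotas on
pairwise disjoint candidate groups, together with its downward closure, forms a
matroid of rank `k` (provided some committee satisfying the quotas exists):
it contains the empty set, is closed under subsets, satisfies the exchange
axiom, and all its maximal members have cardinality `k`. -/
theorem quota_matroid
    {C : Type*} [Fintype C] [DecidableEq C]
    (s : ℕ) (grp : Fin s → Finset C)
    (hdisj : ∀ i j, i ≠ j → Disjoint (grp i) (grp j))
    (hpart : Finset.univ.biUnion grp = Finset.univ)
    (k : ℕ) (qlo qhi : Fin s → ℕ) (hq : ∀ i, qlo i ≤ qhi i)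
    (I : Set (Finset C))
    (hI : I = {W : Finset C | W.card = k ∧
      ∀ i, qlo i ≤ (W ∩ grp i).card ∧ (W ∩ grp i).card ≤ qhi i})
    (𝓘 : Set (Finset C))
    (h𝓘 : 𝓘 = I ∪ {W' : Finset C | ∃ W ∈ I, W' ⊆ W})
    (hne : I.Nonempty) :
    (∅ ∈ 𝓘) ∧
    (∀ A ∈ 𝓘, ∀ B ⊆ A, B ∈ 𝓘) ∧
    (∀ A ∈ 𝓘, ∀ B ∈ 𝓘, B.card < A.card → ∃ x ∈ A \ B, insert x B ∈ 𝓘) ∧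
    (∀ W ∈ 𝓘, (∀ W' ∈ 𝓘, W ⊆ W' → W' = W) → W.card = k) := by
  have hmem : ∀ B, B ∈ 𝓘 ↔ ∃ W ∈ I, B ⊆ W := by
    intro B
    rw [h𝓘]
    exact ⟨fun h => h.elim (fun h => ⟨B, h, Finset.Subset.refl B⟩) id, Or.inr⟩
  simp only [hmem]
  refine ⟨?_, ?_, ?_, ?_⟩
  · obtain ⟨W, hW⟩ := hne
    exact ⟨W, hW, Finset.empty_subset W⟩
  · rintro A ⟨W, hW, hAW⟩ B hBA
    exact ⟨W, hW, hBA.trans hAW⟩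
  · subst hI
    rintro A ⟨V, ⟨hVk, hV⟩, hAV⟩ B ⟨W, ⟨hWk, hW⟩, hBW⟩ hcard
    obtain ⟨x, hx, U, hUW, hU, hsub⟩ := exists_insert_subset_of_quotas hdisj hpart
      (hVk.trans hWk.symm) hV hW hAV hBW hcard
    exact ⟨x, hx, U, ⟨hUW.trans hWk, hU⟩, hsub⟩
  · rintro W ⟨V, hV, hWV⟩ hmax
    rw [← hmax V ⟨V, hV, Finset.Subset.refl V⟩ hWV]
    rw [hI] at hV
    exact hV.1
end

section
/- Define the real sequence (α_j)_{j≥0} by α_0 = 0, α_1 = 1 − 1/e, and α_{j+1} = (j+1)α_j − j·α_{j−1} − 1/e for j ≥ 1. Then for all j ≥ 0 one has α_{j+1} > α_j (the sequence is strictly increasing), and for all j ≥ 0 one has α_{j+2} − α_{j+1} ≤ α_{j+1} − α_j (the increments are non-increasing). -/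
/-- The optimal weights of the non-oblivious local search algorithm for
Maximum Coverage over a matroid constraint: `α 0 = 0`, `α 1 = 1 - 1/e`, and
`α (j+1) = (j+1)·α j - j·α (j-1) - 1/e` for `j ≥ 1`. -/
noncomputable def alphaSeq : ℕ → ℝ
  | 0 => 0
  | 1 => 1 - (Real.exp 1)⁻¹
  | (j + 2) => ((j : ℝ) + 2) * alphaSeq (j + 1) - ((j : ℝ) + 1) * alphaSeq j - (Real.exp 1)⁻¹

theorem integral_pow_succ_mul_exp_neg (j : ℕ) :
    ∫ t in (0 : ℝ)..1, t ^ (j + 1) * Real.exp (-t) =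
      ((j : ℝ) + 1) * (∫ t in (0 : ℝ)..1, t ^ j * Real.exp (-t)) - (Real.exp 1)⁻¹ := by
  have hderiv : ∀ t ∈ Set.uIcc (0 : ℝ) 1, HasDerivAt (fun t : ℝ => t ^ (j + 1) * Real.exp (-t))
      (((j : ℝ) + 1) * (t ^ j * Real.exp (-t)) - t ^ (j + 1) * Real.exp (-t)) t := by
    intro t _
    refine ((hasDerivAt_pow (j + 1) t).mul (hasDerivAt_neg t).exp).congr_deriv ?_
    push_cast [Nat.add_sub_cancel]
    ring
  have hint (k : ℕ) : IntervalIntegrable (fun t : ℝ => t ^ k * Real.exp (-t))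
      MeasureTheory.volume 0 1 :=
    Continuous.intervalIntegrable (by fun_prop) _ _
  have h := intervalIntegral.integral_eq_sub_of_hasDerivAt hderiv
    (((hint j).const_mul _).sub (hint (j + 1)))
  rw [intervalIntegral.integral_sub ((hint j).const_mul _) (hint (j + 1)),
    intervalIntegral.integral_const_mul] at h
  simp only [one_pow, one_mul, Real.exp_neg, ne_eq, Nat.add_eq_zero_iff, one_ne_zero, and_false,
    not_false_eq_true, zero_pow, zero_mul, sub_zero] at h ⊢
  linarith

theorem alphaSeq_succ_sub_eq_integral (j : ℕ) :
    alphaSeq (j + 1) - alphaSeq j = ∫ t in (0 : ℝ)..1, t ^ j * Real.exp (-t) := by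
  induction j with
  | zero => simp [alphaSeq, Real.exp_neg 1]
  | succ j ih =>
    rw [integral_pow_succ_mul_exp_neg, ← ih, alphaSeq]
    ring

/-- The sequence `(α_j)` is strictly increasing and its increments are
non-increasing. -/
theorem alphaSeq_strictMono_and_concave :
    (∀ j : ℕ, alphaSeq j < alphaSeq (j + 1)) ∧
    (∀ j : ℕ, alphaSeq (j + 2) - alphaSeq (j + 1) ≤ alphaSeq (j + 1) - alphaSeq j) := by
  refine ⟨fun j => ?_, fun j => ?_⟩
  · rw [← sub_pos, alphaSeq_succ_sub_eq_integral]
    refine intervalIntegral.intervalIntegral_pos_of_pos_on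
      (Continuous.intervalIntegrable (by fun_prop) _ _) (fun t ht => ?_) one_pos
    exact mul_pos (pow_pos ht.1 j) (Real.exp_pos _)
  · rw [alphaSeq_succ_sub_eq_integral, alphaSeq_succ_sub_eq_integral]
    refine intervalIntegral.integral_mono_on zero_le_one
      (Continuous.intervalIntegrable (by fun_prop) _ _)
      (Continuous.intervalIntegrable (by fun_prop) _ _) (fun t ht => ?_)
    exact mul_le_mul_of_nonneg_right (pow_le_pow_of_le_one ht.1 ht.2 j.le_succ) (Real.exp_pos _).le
end
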